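/- Let α be real with |α| > 1 and let ψ : ℤ → ℂ be rapidly decaying. Then Q_A(ψ) + P(ψ) ≤ 𝓔₂(ψ) ≤ 2 (Q_A(ψ) + P(ψ)). -/

import Mathlib

/-- `S(β) = (α² + β²)^{1/2}`. -/
noncomputable def Sv (α : ℝ) (β : ℤ) : ℝ := Real.sqrt (α ^ 2 + (β : ℝ) ^ 2)

/-- A sequence `ψ : ℤ → ℂ` is rapidly decaying if `Σ_β (1+β²)^k |ψ(β)|² < ∞` for all `k`. -/
def RapidlyDecayingSeq (ψ : ℤ → ℂ) : Prop :=
  ∀ k : ℕ, Summable (fun β : ℤ => (1 + (β : ℝ) ^ 2) ^ k * ‖ψ β‖ ^ 2)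

/-- `u(β) = (S(β) − 1) ψ(β)`. -/
noncomputable def useq (α : ℝ) (ψ : ℤ → ℂ) (β : ℤ) : ℂ := ((Sv α β - 1 : ℝ) : ℂ) * ψ β

/-- `Q_A(ψ) = (1/4) Σ_β |u(β−1) − u(β+1)|²`. -/
noncomputable def QA (α : ℝ) (ψ : ℤ → ℂ) : ℝ :=
  (1 / 4) * ∑' β : ℤ, ‖useq α ψ (β - 1) - useq α ψ (β + 1)‖ ^ 2

/-- `P(ψ) = Σ_β (S(β) − 1) |ψ(β)|²`. -/
noncomputable def Pfun (α : ℝ) (ψ : ℤ → ℂ) : ℝ := ∑' β : ℤ, (Sv α β - 1) * ‖ψ β‖ ^ 2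

/-- `𝓔₂(ψ) = Σ_β (S(β)−1) S(β) |ψ(β)|² − (1/4) Σ_β ((S(β)−1)/S(β)) |u(β−1) + u(β+1)|²`. -/
noncomputable def E2 (α : ℝ) (ψ : ℤ → ℂ) : ℝ :=
  (∑' β : ℤ, (Sv α β - 1) * Sv α β * ‖ψ β‖ ^ 2)
    - (1 / 4) * ∑' β : ℤ, ((Sv α β - 1) / Sv α β) * ‖useq α ψ (β - 1) + useq α ψ (β + 1)‖ ^ 2

theorem Sv_one_lt (α : ℝ) (hα : 1 < |α|) (β : ℤ) : 1 < Sv α β := by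
  unfold Sv
  rw [Real.lt_sqrt (by norm_num)]
  have : 1 < α ^ 2 := by rw [← sq_abs]; nlinarith
  nlinarith [sq_nonneg (β : ℝ)]

theorem Sv_sq (α : ℝ) (β : ℤ) : Sv α β ^ 2 = α ^ 2 + (β : ℝ) ^ 2 := by
  unfold Sv
  exact Real.sq_sqrt (by positivity)

theorem Sv_lip (α : ℝ) (hα : 1 < |α|) (β γ : ℤ) (h : β = γ + 1 ∨ γ = β + 1) :
    Sv α β - 1 ≤ Sv α γ := by
  have h1 := Sv_sq α β
  have h2 := Sv_sq α γ
  have h3 := Sv_one_lt α hα β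
  have h4 := Sv_one_lt α hα γ
  have h5 : |(γ : ℝ)| ≤ Sv α γ := by
    refine abs_le_of_sq_le_sq ?_ (by linarith)
    nlinarith [sq_nonneg α]
  obtain ⟨h6, h7⟩ := abs_le.mp h5
  have : Sv α β ≤ Sv α γ + 1 := by
    refine (sq_le_sq₀ (by linarith) (by linarith)).mp ?_
    rcases h with h | h
    · subst h; push_cast at *; nlinarith
    · have : (β : ℝ) = γ - 1 := by subst h; push_cast; ring
      rw [this] at h1; nlinarith
  linarith

theorem E2_equivalence (α : ℝ) (hα : 1 < |α|) (ψ : ℤ → ℂ) (hψ : RapidlyDecayingSeq ψ) :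
    QA α ψ + Pfun α ψ ≤ E2 α ψ ∧ E2 α ψ ≤ 2 * (QA α ψ + Pfun α ψ) := by
  have hS := Sv_one_lt α hα
  have hα2 : 1 < α ^ 2 := by rw [← sq_abs]; nlinarith
  have hdom : Summable (fun β : ℤ => α ^ 2 * ((1 + (β : ℝ) ^ 2) * ‖ψ β‖ ^ 2)) := by
    have := (hψ 1).mul_left (α ^ 2)
    simpa using this
  have hSS : ∀ β, Sv α β ^ 2 ≤ α ^ 2 * (1 + (β : ℝ) ^ 2) := fun β => by
    rw [Sv_sq]; nlinarith [sq_nonneg (β : ℝ)]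
  set f : ℤ → ℝ := fun β => ‖useq α ψ β‖ ^ 2 with hf
  set p : ℤ → ℝ := fun β => (Sv α β - 1) * ‖ψ β‖ ^ 2 with hp
  have hfp : ∀ β, f β = (Sv α β - 1) * p β := fun β => by
    simp only [hf, hp, useq, norm_mul, Complex.norm_real, Real.norm_eq_abs, mul_pow, sq_abs]
    ring
  have hp0 : ∀ β, 0 ≤ p β := fun β => mul_nonneg (by linarith [hS β]) (by positivity)
  have hf0 : ∀ β, 0 ≤ f β := fun β => by positivity
  have sp : Summable p := by
    refine Summable.of_nonneg_of_le hp0 (fun β => ?_) hdom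
    rw [← mul_assoc]
    exact mul_le_mul_of_nonneg_right (by nlinarith [hS β, hSS β]) (by positivity)
  have sf : Summable f := by
    refine Summable.of_nonneg_of_le hf0 (fun β => ?_) hdom
    rw [hfp, ← mul_assoc, ← mul_assoc]
    exact mul_le_mul_of_nonneg_right (by nlinarith [hS β, hSS β]) (by positivity)
  have shift : ∀ g : ℤ → ℝ, Summable g →
      HasSum (fun β => 2 * g (β - 1) + 2 * g (β + 1)) (4 * ∑' β, g β) := by
    intro g hg
    have h1 : HasSum (fun β => g (β - 1)) (∑' β, g β) :=
      (Equiv.subRight (1 : ℤ)).hasSum_iff.mpr hg.hasSum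
    have h2 : HasSum (fun β => g (β + 1)) (∑' β, g β) :=
      (Equiv.addRight (1 : ℤ)).hasSum_iff.mpr hg.hasSum
    have h3 := (h1.mul_left 2).add (h2.mul_left 2)
    have h4 : 2 * ∑' β, g β + 2 * ∑' β, g β = 4 * ∑' β, g β := by ring
    rwa [h4] at h3
  set D : ℤ → ℝ := fun β => ‖useq α ψ (β - 1) - useq α ψ (β + 1)‖ ^ 2 with hD
  set T : ℤ → ℝ := fun β => ‖useq α ψ (β - 1) + useq α ψ (β + 1)‖ ^ 2 with hT
  have hD0 : ∀ β, 0 ≤ D β := fun β => by positivity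
  have hT0 : ∀ β, 0 ≤ T β := fun β => by positivity
  have par : ∀ β, T β + D β = 2 * f (β - 1) + 2 * f (β + 1) := fun β => by
    have := parallelogram_law_with_norm ℝ (useq α ψ (β - 1)) (useq α ψ (β + 1))
    simp only [hT, hD, hf]
    linarith
  have Hf := shift f sf
  have Hp := shift p sp
  have sT : Summable T :=
    Summable.of_nonneg_of_le hT0 (fun β => by linarith [par β, hD0 β]) Hf.summable
  have sD : Summable D :=
    Summable.of_nonneg_of_le hD0 (fun β => by linarith [par β, hT0 β]) Hf.summable
  have eTD : ∑' β, T β + ∑' β, D β = 4 * ∑' β, f β := by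
    rw [← sT.tsum_add sD, ← Hf.tsum_eq]
    exact tsum_congr par
  set r : ℤ → ℝ := fun β => T β / Sv α β with hr
  have hr0 : ∀ β, 0 ≤ r β := fun β => div_nonneg (hT0 β) (by linarith [hS β])
  have hrp : ∀ β, r β ≤ 2 * p (β - 1) + 2 * p (β + 1) := fun β => by
    simp only [hr]
    rw [div_le_iff₀ (by linarith [hS β])]
    have h1 := mul_le_mul_of_nonneg_right (Sv_lip α hα (β - 1) β (by omega)) (hp0 (β - 1))
    have h2 := mul_le_mul_of_nonneg_right (Sv_lip α hα (β + 1) β (by omega)) (hp0 (β + 1))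
    rw [← hfp] at h1 h2
    linarith [par β, hD0 β]
  have sr : Summable r := Summable.of_nonneg_of_le hr0 hrp Hp.summable
  have er0 : 0 ≤ ∑' β, r β := tsum_nonneg hr0
  have er : ∑' β, r β ≤ 4 * ∑' β, p β := by
    rw [← Hp.tsum_eq]
    exact sr.tsum_le_tsum hrp Hp.summable
  have e1 : ∑' β : ℤ, (Sv α β - 1) * Sv α β * ‖ψ β‖ ^ 2 = ∑' β, f β + ∑' β, p β := by
    rw [← sf.tsum_add sp]
    refine tsum_congr fun β => ?_
    rw [hfp]; simp only [hp]; ring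
  have e2 : ∑' β : ℤ, ((Sv α β - 1) / Sv α β) * T β = ∑' β, T β - ∑' β, r β := by
    rw [← sT.tsum_sub sr]
    refine tsum_congr fun β => ?_
    have : Sv α β ≠ 0 := by linarith [hS β]
    simp only [hr]; field_simp
  have hE : E2 α ψ = (∑' β, f β + ∑' β, p β) - (1 / 4) * (∑' β, T β - ∑' β, r β) := by
    rw [← e1, ← e2]; rfl
  have hQ : QA α ψ = (1 / 4) * ∑' β, D β := rfl
  have hP : Pfun α ψ = ∑' β, p β := rfl
  have hD1 : 0 ≤ ∑' β, D β := tsum_nonneg hD0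
  rw [hE, hQ, hP]
  constructor <;> linarith
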